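/- Let N ≥ 2, n ≥ 1, 1 < p_1,…,p_N < ∞ and 1/p_1+⋯+1/p_N = 1/p. If α_1, α_2 ∈ ℝ satisfy α_1/p_1 + α_2/p_2 > -n/p and α_k < n(p_k - 1) for k = 1, 2, then the tuple of weights (w_1, w_2, w_3, …, w_N) = (|x|^{α_1}, |x|^{α_2}, 1, …, 1) belongs to the class A_{(p_1,…,p_N)}. -/

import Mathlib

open MeasureTheory
open scoped BigOperators

noncomputable section

/-- The axis-parallel cube with lower corner `c` and side length `h` in `ℝⁿ`. -/
def cube (n : ℕ) (c : Fin n → ℝ) (h : ℝ) : Set (EuclideanSpace ℝ (Fin n)) :=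
  {x | ∀ i, c i ≤ x i ∧ x i ≤ c i + h}

/-- The multilinear Muckenhoupt class `A_{(r₁,…,r_N)}`: here `r : Fin N → ℝ` is the tuple
of exponents and `p` the combined exponent with `1/p = Σ 1/r k`.  Membership means that
`sup_Q (|Q|⁻¹ ∫_Q Π_k w_k^{p/r_k})^{1/p} Π_k (|Q|⁻¹ ∫_Q w_k^{1-r_k'})^{1/r_k'} < ∞`,
where `1 - r_k' = 1 - r_k/(r_k - 1)` and `1/r_k' = 1 - 1/r_k`. -/
def IsMultiAp (n N : ℕ) (p : ℝ) (r : Fin N → ℝ)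
    (w : Fin N → EuclideanSpace ℝ (Fin n) → ℝ) : Prop :=
  ∃ A : ℝ, ∀ (c : Fin n → ℝ) (h : ℝ), 0 < h →
    ((h ^ n)⁻¹ * ∫ x in cube n c h, ∏ k, w k x ^ (p / r k)) ^ (1 / p) *
      ∏ k, ((h ^ n)⁻¹ *
        ∫ x in cube n c h, w k x ^ (1 - r k / (r k - 1))) ^ (1 - 1 / r k) ≤ A

lemma volume_cube (n : ℕ) (c : Fin n → ℝ) {h : ℝ} (hh : 0 < h) :
    volume (cube n c h) = ENNReal.ofReal (h ^ n) := by
  have hc : cube n c h = WithLp.ofLp ⁻¹' Set.Icc c (fun i => c i + h) := by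
    ext x
    simp [cube, Pi.le_def, forall_and]
  rw [hc, (PiLp.volume_preserving_ofLp (Fin n)).measure_preimage
    measurableSet_Icc.nullMeasurableSet, Real.volume_Icc_pi]
  simp [ENNReal.ofReal_pow hh.le]

lemma norm_ofLp_le_norm {n : ℕ} (x : EuclideanSpace ℝ (Fin n)) : ‖x.ofLp‖ ≤ ‖x‖ :=
  (pi_norm_le_iff_of_nonneg (norm_nonneg x)).2 fun i => PiLp.norm_apply_le x i

lemma norm_le_card_mul_norm_ofLp {n : ℕ} (x : EuclideanSpace ℝ (Fin n)) :
    ‖x‖ ≤ n * ‖x.ofLp‖ := by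
  rw [EuclideanSpace.norm_eq]
  refine Real.sqrt_le_iff.2 ⟨by positivity, ?_⟩
  calc ∑ i, ‖x i‖ ^ 2 ≤ ∑ _i : Fin n, ‖x.ofLp‖ ^ 2 := by
        gcongr with i
        exact norm_le_pi_norm x.ofLp i
    _ = n * ‖x.ofLp‖ ^ 2 := by simp
    _ ≤ (n : ℝ) ^ 2 * ‖x.ofLp‖ ^ 2 := by
        gcongr
        exact_mod_cast Nat.le_self_pow two_ne_zero n
    _ = (n * ‖x.ofLp‖) ^ 2 := by ring

lemma norm_ofLp_sub_le_of_mem_cube {n : ℕ} {c : Fin n → ℝ} {h : ℝ} (hh : 0 < h)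
    {x : EuclideanSpace ℝ (Fin n)} (hx : x ∈ cube n c h) : ‖x.ofLp - c‖ ≤ h := by
  refine (pi_norm_le_iff_of_nonneg hh.le).2 fun i => ?_
  rw [Pi.sub_apply, Real.norm_eq_abs, abs_le]
  constructor <;> linarith [(hx i).1, (hx i).2]

lemma integrableOn_ball_norm_rpow {n : ℕ} (hn : 1 ≤ n) {a : ℝ} (ha : -(n : ℝ) < a) (R : ℝ) :
    IntegrableOn (fun x : EuclideanSpace ℝ (Fin n) => ‖x‖ ^ a) (Metric.ball 0 R) := by
  refine integrableOn_ball_of_norm_le_rpow (C := 1) (α := -a) (by simpa using hn)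
    (by simp; linarith) (Filter.Eventually.of_forall fun x => ?_)
    (by fun_prop : Measurable _).aestronglyMeasurable
  rw [neg_neg, one_mul, Real.norm_of_nonneg (by positivity)]

lemma setIntegral_ball_norm_rpow (n : ℕ) (a : ℝ) {R : ℝ} (hR : 0 < R) :
    ∫ x in Metric.ball (0 : EuclideanSpace ℝ (Fin n)) R, ‖x‖ ^ a =
      R ^ n * (R ^ a * ∫ x in Metric.ball (0 : EuclideanSpace ℝ (Fin n)) 1, ‖x‖ ^ a) := by
  have key := Measure.setIntegral_comp_smul_of_pos volume
    (fun x : EuclideanSpace ℝ (Fin n) => ‖x‖ ^ a) (Metric.ball 0 1) hR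
  simp only [smul_unitBall_of_pos hR, norm_smul, Real.norm_of_nonneg hR.le,
    Real.mul_rpow hR.le (norm_nonneg _), integral_const_mul, finrank_euclideanSpace,
    Fintype.card_fin, smul_eq_mul] at key
  rw [key, mul_inv_cancel_left₀ (by positivity)]

/-- The mean of `|x|^a`, `a > -n`, over a cube with corner `c` and side `h` is at most a
constant times `(|c| + h)^a`. -/
lemma exists_cube_average_norm_rpow_le {n : ℕ} (hn : 1 ≤ n) {a : ℝ} (ha : -(n : ℝ) < a) :
    ∃ C : ℝ, 0 ≤ C ∧ ∀ (c : Fin n → ℝ) (h : ℝ), 0 < h →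
      (h ^ n)⁻¹ * ∫ x in cube n c h, ‖x‖ ^ a ≤ C * (‖c‖ + h) ^ a := by
  set I := ∫ x in Metric.ball (0 : EuclideanSpace ℝ (Fin n)) 1, ‖x‖ ^ a
  have hI : 0 ≤ I := integral_nonneg fun x => by positivity
  have hn' : (0 : ℝ) < n := by exact_mod_cast hn
  refine ⟨((1 / 3) ^ a + n ^ a) + (6 * n) ^ n * ((2 * n) ^ a * I), by positivity,
    fun c h hh => ?_⟩
  set M := ‖c‖ + h
  have hM : 0 < M := by positivity
  have upper : ∀ x ∈ cube n c h, ‖x‖ ≤ n * M := fun x hx => by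
    refine (norm_le_card_mul_norm_ofLp x).trans ?_
    gcongr
    linarith [norm_sub_norm_le x.ofLp c, norm_ofLp_sub_le_of_mem_cube hh hx]
  rw [inv_mul_le_iff₀ (by positivity)]
  rcases le_or_gt (2 * h) ‖c‖ with hc | hc
  · have bound : ∀ x ∈ cube n c h, ‖‖x‖ ^ a‖ ≤ ((1 / 3) ^ a + n ^ a) * M ^ a := fun x hx => by
      have lower : 1 / 3 * M ≤ ‖x‖ := by
        have := norm_ofLp_le_norm x
        have := norm_sub_norm_le c x.ofLp
        rw [norm_sub_rev] at this
        linarith [norm_ofLp_sub_le_of_mem_cube hh hx]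
      rw [Real.norm_of_nonneg (by positivity), add_mul, ← Real.mul_rpow (by norm_num) hM.le,
        ← Real.mul_rpow hn'.le hM.le]
      rcases le_total 0 a with h0 | h0
      · exact (Real.rpow_le_rpow (norm_nonneg x) (upper x hx) h0).trans
          (le_add_of_nonneg_left (by positivity))
      · exact (Real.rpow_le_rpow_of_nonpos (by positivity) lower h0).trans
          (le_add_of_nonneg_right (by positivity))
    have key := norm_setIntegral_le_of_norm_le_const (μ := volume)
      (by rw [volume_cube n c hh]; exact ENNReal.ofReal_lt_top) bound
    rw [measureReal_def, volume_cube n c hh, ENNReal.toReal_ofReal (by positivity)] at key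
    calc ∫ x in cube n c h, ‖x‖ ^ a ≤ ((1 / 3) ^ a + n ^ a) * M ^ a * h ^ n :=
          (Real.le_norm_self _).trans key
      _ = h ^ n * (((1 / 3) ^ a + n ^ a) * M ^ a) := by ring
      _ ≤ _ := by
          gcongr h ^ n * (?_ * M ^ a)
          exact le_add_of_nonneg_right (by positivity)
  · have hsub : cube n c h ⊆ Metric.ball 0 (2 * n * M) := fun x hx => by
      rw [mem_ball_zero_iff]
      have : 0 < n * M := by positivity
      linarith [upper x hx]
    calc ∫ x in cube n c h, ‖x‖ ^ a
        ≤ ∫ x in Metric.ball 0 (2 * n * M), ‖x‖ ^ a :=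
          setIntegral_mono_set (integrableOn_ball_norm_rpow hn ha _)
            (Filter.Eventually.of_forall fun x => by positivity) hsub.eventuallyLE
      _ = (2 * n * M) ^ n * ((2 * n) ^ a * M ^ a * I) := by
          rw [setIntegral_ball_norm_rpow n a (by positivity),
            Real.mul_rpow (by positivity) hM.le]
      _ ≤ (2 * n * (3 * h)) ^ n * ((2 * n) ^ a * M ^ a * I) := by
          gcongr
          linarith
      _ = h ^ n * ((6 * n) ^ n * ((2 * n) ^ a * I) * M ^ a) := by
          rw [show 2 * n * (3 * h) = h * (6 * n) by ring, mul_pow]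
          ring
      _ ≤ _ := by
          gcongr h ^ n * (?_ * M ^ a)
          exact le_add_of_nonneg_left (by positivity)

lemma isMultiAp_norm_rpow {n N : ℕ} (hn : 1 ≤ n) {p : ℝ} (hp : 0 < p) {r : Fin N → ℝ}
    (hr : ∀ k, 1 < r k) {β : Fin N → ℝ} (hβ : ∀ k, β k < n * (r k - 1))
    (hsum : -(n : ℝ) / p < ∑ k, β k / r k) :
    IsMultiAp n N p r (fun k x => ‖x‖ ^ β k) := by
  have : Nonempty (Fin n) := ⟨⟨0, hn⟩⟩
  set s := ∑ k, β k / r k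
  have hs : -(n : ℝ) < s * p := (div_lt_iff₀ hp).1 hsum
  obtain ⟨C, hC, hCle⟩ := exists_cube_average_norm_rpow_le hn hs
  have hdual : ∀ k, -(n : ℝ) < β k * (1 - r k / (r k - 1)) := fun k => by
    have h1 : 0 < r k - 1 := sub_pos.2 (hr k)
    have h2 : β k * (1 - r k / (r k - 1)) = -(β k / (r k - 1)) := by
      field_simp
      ring
    rw [h2, neg_lt_neg_iff, div_lt_iff₀ h1]
    exact hβ k
  choose D hD hDle using fun k => exists_cube_average_norm_rpow_le hn (hdual k)
  refine ⟨C ^ (1 / p) * ∏ k, D k ^ (1 - 1 / r k), fun c h hh => ?_⟩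
  have hM : 0 < ‖c‖ + h := by positivity
  have hprod : ∫ x in cube n c h, ∏ k, (‖x‖ ^ β k) ^ (p / r k) =
      ∫ x in cube n c h, ‖x‖ ^ (s * p) := by
    refine integral_congr_ae (ae_restrict_of_ae ?_)
    filter_upwards [Measure.ae_ne volume (0 : EuclideanSpace ℝ (Fin n))] with x hx
    simp only [← Real.rpow_mul (norm_nonneg x)]
    rw [← Real.rpow_sum_of_pos (norm_pos_iff.2 hx), Finset.sum_mul]
    congr 1
    exact Finset.sum_congr rfl fun k _ => by ring
  have hfirst : ((h ^ n)⁻¹ * ∫ x in cube n c h, ∏ k, (‖x‖ ^ β k) ^ (p / r k)) ^ (1 / p) ≤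
      C ^ (1 / p) * (‖c‖ + h) ^ s := by
    rw [hprod]
    refine (Real.rpow_le_rpow (mul_nonneg (by positivity)
      (integral_nonneg fun x => by positivity)) (hCle c h hh) (by positivity)).trans_eq ?_
    rw [Real.mul_rpow hC (by positivity), ← Real.rpow_mul hM.le, mul_assoc,
      mul_one_div_cancel hp.ne', mul_one]
  have hnonneg : ∀ k, 0 ≤ (h ^ n)⁻¹ * ∫ x in cube n c h, (‖x‖ ^ β k) ^ (1 - r k / (r k - 1)) :=
    fun k => mul_nonneg (by positivity) (integral_nonneg fun x => by positivity)
  have hfactor : ∀ k, ((h ^ n)⁻¹ *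
      ∫ x in cube n c h, (‖x‖ ^ β k) ^ (1 - r k / (r k - 1))) ^ (1 - 1 / r k) ≤
      D k ^ (1 - 1 / r k) * (‖c‖ + h) ^ (-(β k / r k)) := fun k => by
    have h0 : 0 < r k := one_pos.trans (hr k)
    have h1 : r k - 1 ≠ 0 := (sub_pos.2 (hr k)).ne'
    have hexp : 0 ≤ 1 - 1 / r k := sub_nonneg.2 ((div_le_one h0).2 (hr k).le)
    refine (Real.rpow_le_rpow (hnonneg k) ?_ hexp).trans_eq
      (b := (D k * (‖c‖ + h) ^ (β k * (1 - r k / (r k - 1)))) ^ (1 - 1 / r k)) ?_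
    · simpa only [← Real.rpow_mul (norm_nonneg _)] using hDle k c h hh
    · rw [Real.mul_rpow (hD k) (by positivity), ← Real.rpow_mul hM.le]
      congr 2
      field_simp
      ring
  calc _ ≤ C ^ (1 / p) * (‖c‖ + h) ^ s *
        ∏ k, (D k ^ (1 - 1 / r k) * (‖c‖ + h) ^ (-(β k / r k))) :=
        mul_le_mul hfirst
          (Finset.prod_le_prod (fun k _ => Real.rpow_nonneg (hnonneg k) _) fun k _ => hfactor k)
          (Finset.prod_nonneg fun k _ => Real.rpow_nonneg (hnonneg k) _) (by positivity)
    _ = C ^ (1 / p) * (∏ k, D k ^ (1 - 1 / r k)) * ((‖c‖ + h) ^ s * (‖c‖ + h) ^ (-s)) := by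
        rw [Finset.prod_mul_distrib, ← Real.rpow_sum_of_pos hM, Finset.sum_neg_distrib]
        ring
    _ = _ := by rw [← Real.rpow_add hM, add_neg_cancel, Real.rpow_zero, mul_one]

/-- Let `N ≥ 2`, `n ≥ 1`, `1 < p_k < ∞` and `1/p = 1/p₁ + ⋯ + 1/p_N`.
If `α₁/p₁ + α₂/p₂ > -n/p` and `α_k < n(p_k - 1)` for `k = 1, 2`, then
`(|x|^{α₁}, |x|^{α₂}, 1, …, 1) ∈ A_{(p₁,…,p_N)}`. -/
theorem stmt_3 (N n : ℕ) (hN : 2 ≤ N) (hn : 1 ≤ n) (p : ℝ) (pk : Fin N → ℝ)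
    (hpk : ∀ k, 1 < pk k) (hp : 1 / p = ∑ k, 1 / pk k)
    (α₁ α₂ : ℝ)
    (hα : -(n : ℝ) / p < α₁ / pk ⟨0, by omega⟩ + α₂ / pk ⟨1, by omega⟩)
    (hα₁ : α₁ < n * (pk ⟨0, by omega⟩ - 1)) (hα₂ : α₂ < n * (pk ⟨1, by omega⟩ - 1)) :
    IsMultiAp n N p pk
      (fun k x => if (k : ℕ) = 0 then ‖x‖ ^ α₁ else if (k : ℕ) = 1 then ‖x‖ ^ α₂ else 1) := by
  have hp0 : 0 < p := by
    rw [← one_div_pos, hp]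
    exact Finset.sum_pos (fun k _ => one_div_pos.2 (one_pos.trans (hpk k)))
      ⟨⟨0, by omega⟩, Finset.mem_univ _⟩
  set β : Fin N → ℝ := fun k => if (k : ℕ) = 0 then α₁ else if (k : ℕ) = 1 then α₂ else 0
    with hβdef
  have hw : (fun (k : Fin N) (x : EuclideanSpace ℝ (Fin n)) =>
      if (k : ℕ) = 0 then ‖x‖ ^ α₁ else if (k : ℕ) = 1 then ‖x‖ ^ α₂ else 1) =
      fun k x => ‖x‖ ^ β k := by
    ext k x
    simp only [hβdef]
    split_ifs <;> simp
  rw [hw]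
  refine isMultiAp_norm_rpow hn hp0 hpk (fun k => ?_) ?_
  · simp only [hβdef]
    split_ifs with h0 h1
    · rwa [show k = ⟨0, by omega⟩ from Fin.ext h0]
    · rwa [show k = ⟨1, by omega⟩ from Fin.ext h1]
    · have : (0 : ℝ) < n := by exact_mod_cast hn
      exact mul_pos this (sub_pos.2 (hpk k))
  · rwa [Fintype.sum_eq_add (⟨0, by omega⟩ : Fin N) ⟨1, by omega⟩ (by simp)]
    rintro k ⟨h0, h1⟩
    have h0' : (k : ℕ) ≠ 0 := fun h => h0 (Fin.ext h)
    have h1' : (k : ℕ) ≠ 1 := fun h => h1 (Fin.ext h)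
    simp [hβdef, h0', h1']

end
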